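/- arXiv:2411.11125 — 4 statements merged into one kernel-verified Lean document; each statement's English description precedes it below -/
import Mathlib

section
/- Let A be a real d×ℓ matrix of rank r > 0 and let A = F*G be a full-rank factorization of A (so F is d×r, G is r×ℓ, and both F and G have rank r). Then the r×r matrix Fᵀ*A*Gᵀ is invertible, and the ℓ×d matrix B := Gᵀ*(Fᵀ*A*Gᵀ)⁻¹*Fᵀ satisfies the four Penrose equations A*B*A = A, B*A*B = B, (B*A)ᵀ = B*A, and (A*B)ᵀ = A*B; that is, B is the Moore–Penrose pseudo-inverse of A. -/
open Matrix

/-- A square matrix over a field whose rank is its size is invertible. -/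
theorem isUnit_of_rank_eq_card {n K : Type*} [Fintype n] [DecidableEq n] [Field K]
    {M : Matrix n n K} (hM : M.rank = Fintype.card n) : IsUnit M := by
  rw [← Matrix.mulVec_surjective_iff_isUnit]
  have htop : LinearMap.range M.mulVecLin = ⊤ :=
    Submodule.eq_top_of_finrank_eq (by simpa [Matrix.rank] using hM)
  exact LinearMap.range_eq_top.mp htop

/-- If `A = F*G` is a full-rank factorization of the real `d × ℓ` matrix `A` of rank
`r > 0`, then `Fᵀ*A*Gᵀ` is invertible and `B := Gᵀ*(Fᵀ*A*Gᵀ)⁻¹*Fᵀ` is the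
Moore–Penrose pseudo-inverse of `A`. -/
theorem moore_penrose_of_full_rank_factorization (d ℓ r : ℕ)
    (hd : 0 < d) (hℓ : 0 < ℓ) (hr : 0 < r)
    (A : Matrix (Fin d) (Fin ℓ) ℝ) (hA : A.rank = r)
    (F : Matrix (Fin d) (Fin r) ℝ) (G : Matrix (Fin r) (Fin ℓ) ℝ)
    (hF : F.rank = r) (hG : G.rank = r) (hFG : A = F * G) :
    IsUnit (Fᵀ * A * Gᵀ) ∧
      (A * (Gᵀ * (Fᵀ * A * Gᵀ)⁻¹ * Fᵀ) * A = A ∧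
       (Gᵀ * (Fᵀ * A * Gᵀ)⁻¹ * Fᵀ) * A * (Gᵀ * (Fᵀ * A * Gᵀ)⁻¹ * Fᵀ) =
         Gᵀ * (Fᵀ * A * Gᵀ)⁻¹ * Fᵀ ∧
       ((Gᵀ * (Fᵀ * A * Gᵀ)⁻¹ * Fᵀ) * A)ᵀ = (Gᵀ * (Fᵀ * A * Gᵀ)⁻¹ * Fᵀ) * A ∧
       (A * (Gᵀ * (Fᵀ * A * Gᵀ)⁻¹ * Fᵀ))ᵀ = A * (Gᵀ * (Fᵀ * A * Gᵀ)⁻¹ * Fᵀ)) := by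
  have hP : IsUnit (Fᵀ * F) :=
    isUnit_of_rank_eq_card (by rw [rank_transpose_mul_self, hF, Fintype.card_fin])
  have hQ : IsUnit (G * Gᵀ) :=
    isUnit_of_rank_eq_card (by rw [rank_self_mul_transpose, hG, Fintype.card_fin])
  have hM : Fᵀ * A * Gᵀ = (Fᵀ * F) * (G * Gᵀ) := by
    simp only [hFG, Matrix.mul_assoc]
  have hPdet := (isUnit_iff_isUnit_det _).mp hP
  have hQdet := (isUnit_iff_isUnit_det _).mp hQ
  refine ⟨hM ▸ hP.mul hQ, ?_⟩
  rw [hM, Matrix.mul_inv_rev]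
  set B := Gᵀ * ((G * Gᵀ)⁻¹ * (Fᵀ * F)⁻¹) * Fᵀ with hB
  have hAB : A * B = F * (Fᵀ * F)⁻¹ * Fᵀ := by
    calc A * B = F * ((G * Gᵀ) * (G * Gᵀ)⁻¹) * (Fᵀ * F)⁻¹ * Fᵀ := by
          simp only [hFG, hB, Matrix.mul_assoc]
      _ = F * (Fᵀ * F)⁻¹ * Fᵀ := by rw [mul_nonsing_inv _ hQdet, Matrix.mul_one]
  have hBA : B * A = Gᵀ * (G * Gᵀ)⁻¹ * G := by
    calc B * A = Gᵀ * (G * Gᵀ)⁻¹ * ((Fᵀ * F)⁻¹ * (Fᵀ * F)) * G := by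
          simp only [hFG, hB, Matrix.mul_assoc]
      _ = Gᵀ * (G * Gᵀ)⁻¹ * G := by rw [nonsing_inv_mul _ hPdet, Matrix.mul_one]
  refine ⟨?_, ?_, ?_, ?_⟩
  · calc A * B * A = F * ((Fᵀ * F)⁻¹ * (Fᵀ * F)) * G := by
          rw [hAB, hFG]; simp only [Matrix.mul_assoc]
      _ = A := by rw [nonsing_inv_mul _ hPdet, Matrix.mul_one, hFG]
  · calc B * A * B
        = Gᵀ * ((G * Gᵀ)⁻¹ * (G * Gᵀ)) * ((G * Gᵀ)⁻¹ * (Fᵀ * F)⁻¹) * Fᵀ := by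
          rw [hBA, hB]; simp only [Matrix.mul_assoc]
      _ = B := by rw [nonsing_inv_mul _ hQdet, Matrix.mul_one]
  · rw [hBA]
    simp only [transpose_mul, transpose_transpose, transpose_nonsing_inv, Matrix.mul_assoc]
  · rw [hAB]
    simp only [transpose_mul, transpose_transpose, transpose_nonsing_inv, Matrix.mul_assoc]
end

section
/- The Moore–Penrose pseudo-inverse map is Borel measurable: for any positive integers d and ℓ, if p is the function assigning to each real d×ℓ matrix A the (unique) real ℓ×d matrix p(A) satisfying the four Penrose equations A*p(A)*A = A, p(A)*A*p(A) = p(A), (p(A)*A)ᵀ = p(A)*A, and (A*p(A))ᵀ = A*p(A), then p is measurable from the space of real d×ℓ matrices (with its Borel σ-algebra) to the space of real ℓ×d matrices (with its Borel σ-algebra). -/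
open Matrix MeasureTheory

/-- The Borel σ-algebra on a space of real matrices (for its standard topology, i.e.
the product topology of a finite-dimensional real vector space). -/
noncomputable instance matrixBorelMeasurableSpace (m n : ℕ) :
    MeasurableSpace (Matrix (Fin m) (Fin n) ℝ) := borel _

instance matrixBorelSpace (m n : ℕ) : BorelSpace (Matrix (Fin m) (Fin n) ℝ) :=
  ⟨rfl⟩

/-- If `P` satisfies the Penrose equations for `A`, then the Tikhonov regularisation of the
pseudo-inverse is `(AᵀA + ε)⁻¹ Aᵀ = P (1 + ε PᵀP)⁻¹` whenever both inverses exist. -/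
theorem tikhonov_eq_mul_inv {m n : Type*} [Fintype m] [Fintype n] [DecidableEq m] [DecidableEq n]
    {A : Matrix m n ℝ} {P : Matrix n m ℝ} (h₁ : A * P * A = A) (h₂ : P * A * P = P)
    (h₃ : (P * A)ᵀ = P * A) (h₄ : (A * P)ᵀ = A * P) {ε : ℝ}
    (hM : IsUnit (Aᵀ * A + ε • (1 : Matrix n n ℝ)).det)
    (hK : IsUnit ((1 : Matrix m m ℝ) + ε • (Pᵀ * P)).det) :
    (Aᵀ * A + ε • (1 : Matrix n n ℝ))⁻¹ * Aᵀ = P * (1 + ε • (Pᵀ * P))⁻¹ := by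
  have hA : Aᵀ * A * P = Aᵀ := by
    rw [Matrix.mul_assoc, ← h₄, ← transpose_mul, h₁]
  have hP : Aᵀ * (Pᵀ * P) = P := by
    rw [← Matrix.mul_assoc, ← transpose_mul, h₃, h₂]
  have key : (Aᵀ * A + ε • (1 : Matrix n n ℝ)) * P = Aᵀ * (1 + ε • (Pᵀ * P)) := by
    rw [Matrix.add_mul, Matrix.mul_add, hA, Matrix.mul_smul, hP, Matrix.smul_mul,
      Matrix.one_mul, Matrix.mul_one]
  calc _ = (Aᵀ * A + ε • (1 : Matrix n n ℝ))⁻¹ *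
        (Aᵀ * (1 + ε • (Pᵀ * P)) * (1 + ε • (Pᵀ * P))⁻¹) := by
        rw [mul_nonsing_inv_cancel_right _ _ hK]
    _ = _ := by
        rw [← key, Matrix.mul_assoc, nonsing_inv_mul_cancel_left _ _ hM]

/-- Regularising a real Gram matrix by a positive multiple of the identity makes it invertible. -/
theorem isUnit_det_gram_add_smul_one {m n : Type*} [Fintype m] [Fintype n] [DecidableEq n]
    (A : Matrix m n ℝ) {ε : ℝ} (hε : 0 < ε) :
    IsUnit (Aᵀ * A + ε • (1 : Matrix n n ℝ)).det := by
  have h : (Aᵀ * A + ε • (1 : Matrix n n ℝ)).PosDef := by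
    rw [← conjTranspose_eq_transpose_of_trivial]
    exact (PosDef.one.smul hε).posSemidef_add (posSemidef_conjTranspose_mul_self A)
  exact h.det_pos.ne'.isUnit

/-- The Moore–Penrose pseudo-inverse is the limit of its Tikhonov regularisations. -/
theorem tendsto_tikhonov {m n : Type*} [Fintype m] [Fintype n] [DecidableEq m] [DecidableEq n]
    {A : Matrix m n ℝ} {P : Matrix n m ℝ} (h₁ : A * P * A = A) (h₂ : P * A * P = P)
    (h₃ : (P * A)ᵀ = P * A) (h₄ : (A * P)ᵀ = A * P) :
    Filter.Tendsto (fun ε : ℝ => (Aᵀ * A + ε • (1 : Matrix n n ℝ))⁻¹ * Aᵀ)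
      (nhdsWithin 0 (Set.Ioi 0)) (nhds P) := by
  have hdet : ContinuousAt (fun ε : ℝ => ((1 : Matrix m m ℝ) + ε • (Pᵀ * P)).det) 0 := by
    fun_prop
  have hunit : ∀ᶠ ε : ℝ in nhds 0, IsUnit ((1 : Matrix m m ℝ) + ε • (Pᵀ * P)).det :=
    (hdet.eventually_ne (by simp)).mono fun _ h => h.isUnit
  have hlim : ContinuousAt (fun ε : ℝ => P * ((1 : Matrix m m ℝ) + ε • (Pᵀ * P))⁻¹) 0 := by
    have hmul : Continuous fun X : Matrix m m ℝ => P * X := by fun_prop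
    have hinv : ContinuousAt (fun ε : ℝ => ((1 : Matrix m m ℝ) + ε • (Pᵀ * P))⁻¹) 0 := by
      refine ContinuousAt.comp (g := Inv.inv) (continuousAt_matrix_inv _ ?_) (by fun_prop)
      simp
    exact hmul.continuousAt.comp hinv
  have hlim' := hlim.tendsto.mono_left (nhdsWithin_le_nhds (s := Set.Ioi 0))
  simp only [zero_smul, add_zero, inv_one, Matrix.mul_one] at hlim'
  refine hlim'.congr' ?_
  filter_upwards [self_mem_nhdsWithin, nhdsWithin_le_nhds hunit] with ε hε hK
  exact (tikhonov_eq_mul_inv h₁ h₂ h₃ h₄ (isUnit_det_gram_add_smul_one A hε) hK).symm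

/-- For `ε > 0` the Tikhonov-regularised pseudo-inverse depends continuously on the matrix. -/
theorem continuous_tikhonov {m n : Type*} [Fintype m] [Fintype n] [DecidableEq n]
    {ε : ℝ} (hε : 0 < ε) :
    Continuous fun A : Matrix m n ℝ => (Aᵀ * A + ε • (1 : Matrix n n ℝ))⁻¹ * Aᵀ := by
  refine Continuous.matrix_mul ?_ continuous_id.matrix_transpose
  simp only [Matrix.inv_def, Ring.inverse_eq_inv']
  have hM : Continuous fun A : Matrix m n ℝ => Aᵀ * A + ε • (1 : Matrix n n ℝ) := by fun_prop
  exact (hM.matrix_det.inv₀ fun A => (isUnit_det_gram_add_smul_one A hε).ne_zero).smul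
    hM.matrix_adjugate

/-- The Moore–Penrose pseudo-inverse map is Borel measurable: if `p` assigns to each
real `d × ℓ` matrix `A` the (unique) matrix `p A` satisfying the four Penrose
equations, then `p` is measurable. -/
theorem moore_penrose_measurable (d ℓ : ℕ) (hd : 0 < d) (hℓ : 0 < ℓ)
    (p : Matrix (Fin d) (Fin ℓ) ℝ → Matrix (Fin ℓ) (Fin d) ℝ)
    (hp : ∀ A : Matrix (Fin d) (Fin ℓ) ℝ,
      A * p A * A = A ∧ p A * A * p A = p A ∧
      (p A * A)ᵀ = p A * A ∧ (A * p A)ᵀ = A * p A) :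
    Measurable p := by
  have : TopologicalSpace.PseudoMetrizableSpace (Matrix (Fin ℓ) (Fin d) ℝ) :=
    inferInstanceAs (TopologicalSpace.PseudoMetrizableSpace (Fin ℓ → Fin d → ℝ))
  have hseq : Filter.Tendsto (fun k : ℕ => (1 : ℝ) / (k + 1)) Filter.atTop
      (nhdsWithin 0 (Set.Ioi 0)) :=
    tendsto_nhdsWithin_iff.2
      ⟨tendsto_one_div_add_atTop_nhds_zero_nat, .of_forall fun _ => Set.mem_Ioi.2 Nat.one_div_pos_of_nat⟩
  refine measurable_of_tendsto_metrizable
    (fun k : ℕ => (continuous_tikhonov (Nat.one_div_pos_of_nat (n := k))).measurable)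
    (tendsto_pi_nhds.2 fun A => ?_)
  obtain ⟨h₁, h₂, h₃, h₄⟩ := hp A
  exact (tendsto_tikhonov h₁ h₂ h₃ h₄).comp hseq
end

section
/- Fix positive integers d, ℓ, an integer r with 1 ≤ r ≤ min(d,ℓ), and index sets I of r rows and J of r columns. Let S be the set of real d×ℓ matrices A such that A has rank exactly r and the r×r submatrix of A obtained by selecting the rows in I and the columns in J is invertible. Then the Moore–Penrose pseudo-inverse map A ↦ A⁺ is continuous on S. -/
open Matrix

namespace Matrix

variable {m n k : Type*} [Fintype m] [Fintype n] [Fintype k] [DecidableEq k]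

/-- The four Penrose equations, saying that `B` is the Moore–Penrose pseudo-inverse of `A`. -/
def IsMoorePenroseInverse (A : Matrix m n ℝ) (B : Matrix n m ℝ) : Prop :=
  A * B * A = A ∧ B * A * B = B ∧ (B * A)ᵀ = B * A ∧ (A * B)ᵀ = A * B

theorem IsMoorePenroseInverse.unique {A : Matrix m n ℝ} {B C : Matrix n m ℝ}
    (hB : IsMoorePenroseInverse A B) (hC : IsMoorePenroseInverse A C) : B = C := by
  obtain ⟨hB₁, hB₂, hB₃, hB₄⟩ := hB
  obtain ⟨hC₁, hC₂, hC₃, hC₄⟩ := hC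
  have hAB : A * B = A * C := by
    calc A * B = (A * B)ᵀ := hB₄.symm
      _ = (A * C * A * B)ᵀ := by rw [hC₁]
      _ = (A * B)ᵀ * (A * C)ᵀ := by rw [Matrix.mul_assoc (A * C), transpose_mul]
      _ = A * B * A * C := by rw [hB₄, hC₄, Matrix.mul_assoc (A * B)]
      _ = A * C := by rw [hB₁]
  have hBA : B * A = C * A := by
    calc B * A = (B * A)ᵀ := hB₃.symm
      _ = (B * (A * C * A))ᵀ := by rw [hC₁]
      _ = (C * A)ᵀ * (B * A)ᵀ := by simp only [← transpose_mul, Matrix.mul_assoc]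
      _ = C * (A * B * A) := by rw [hB₃, hC₃]; simp only [Matrix.mul_assoc]
      _ = C * A := by rw [hB₁]
  calc B = B * A * B := hB₂.symm
    _ = C * (A * B) := by rw [hBA, Matrix.mul_assoc]
    _ = C := by rw [hAB, ← Matrix.mul_assoc, hC₂]

/-- A matrix with an invertible maximal square submatrix of rows has invertible Gram matrix. -/
theorem isUnit_transpose_mul_self_of_isUnit_submatrix {C : Matrix m k ℝ} {I : k → m}
    (h : IsUnit (C.submatrix I id)) : IsUnit (Cᵀ * C) := by
  have hinj : Function.Injective C.mulVec := fun v w hvw =>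
    mulVec_injective_of_isUnit h (funext fun i => congrFun hvw (I i))
  simpa using (PosDef.conjTranspose_mul_self C hinj).isUnit

/-- The skeleton (CUR) decomposition: a matrix of rank `card k` is recovered from the columns and
rows through an invertible `k × k` submatrix. -/
theorem eq_skeleton_of_rank_eq {A : Matrix m n ℝ} {I : k → m} {J : k → n}
    (hA : A.rank = Fintype.card k) (h : IsUnit (A.submatrix I J)) :
    A = A.submatrix id J * (A.submatrix I J)⁻¹ * A.submatrix I id := by
  classical
  have hrank : Fintype.card k ≤ (A.submatrix id J).rank := by
    rw [← rank_of_isUnit _ h]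
    exact rank_submatrix_le (A.submatrix id J) I id
  have hspan : Submodule.span ℝ (Set.range (A.submatrix id J).col) =
      Submodule.span ℝ (Set.range A.col) := by
    refine Submodule.eq_of_le_of_finrank_le (Submodule.span_mono ?_) ?_
    · rintro _ ⟨j, rfl⟩
      exact ⟨J j, rfl⟩
    · rwa [← rank_eq_finrank_span_cols, ← rank_eq_finrank_span_cols, hA]
  have hcol (j : n) : ∃ v, A.submatrix id J *ᵥ v = A.col j := by
    have : A.col j ∈ Submodule.span ℝ (Set.range (A.submatrix id J).col) :=
      hspan ▸ Submodule.subset_span ⟨j, rfl⟩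
    rwa [← range_mulVecLin] at this
  choose v hv using hcol
  have hX : A.submatrix id J * (of v)ᵀ = A := by
    ext i j
    exact congrFun (hv j) i
  have hR : A.submatrix I J * (of v)ᵀ = A.submatrix I id := by
    ext i j
    exact congrFun (hv j) (I i)
  rw [Matrix.mul_assoc, ← hR, nonsing_inv_mul_cancel_left _ _ ((isUnit_iff_isUnit_det _).1 h), hX]

/-- MacDuffee's formula for the pseudo-inverse from a full-rank factorization `C * M⁻¹ * R`. -/
theorem isMoorePenroseInverse_of_factorization {C : Matrix m k ℝ} {M : Matrix k k ℝ}
    {R : Matrix k n ℝ} (hM : IsUnit M) (hC : IsUnit (Cᵀ * C)) (hR : IsUnit (R * Rᵀ)) :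
    IsMoorePenroseInverse (C * M⁻¹ * R) (Rᵀ * (R * Rᵀ)⁻¹ * M * (Cᵀ * C)⁻¹ * Cᵀ) := by
  rw [isUnit_iff_isUnit_det] at hM hC hR
  have hBA : Rᵀ * (R * Rᵀ)⁻¹ * M * (Cᵀ * C)⁻¹ * Cᵀ * (C * M⁻¹ * R) = Rᵀ * (R * Rᵀ)⁻¹ * R := by
    calc _ = Rᵀ * (R * Rᵀ)⁻¹ * (M * ((Cᵀ * C)⁻¹ * (Cᵀ * C)) * M⁻¹) * R := by
          simp only [Matrix.mul_assoc]
      _ = _ := by rw [nonsing_inv_mul _ hC, Matrix.mul_one, mul_nonsing_inv _ hM, Matrix.mul_one]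
  have hAB : C * M⁻¹ * R * (Rᵀ * (R * Rᵀ)⁻¹ * M * (Cᵀ * C)⁻¹ * Cᵀ) = C * (Cᵀ * C)⁻¹ * Cᵀ := by
    calc _ = C * (M⁻¹ * ((R * Rᵀ) * (R * Rᵀ)⁻¹) * M) * (Cᵀ * C)⁻¹ * Cᵀ := by
          simp only [Matrix.mul_assoc]
      _ = _ := by rw [mul_nonsing_inv _ hR, Matrix.mul_one, nonsing_inv_mul _ hM, Matrix.mul_one]
  refine ⟨?_, ?_, ?_, ?_⟩
  · rw [hAB]
    calc _ = C * ((Cᵀ * C)⁻¹ * (Cᵀ * C)) * M⁻¹ * R := by simp only [Matrix.mul_assoc]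
      _ = _ := by rw [nonsing_inv_mul _ hC, Matrix.mul_one]
  · rw [hBA]
    calc _ = Rᵀ * ((R * Rᵀ)⁻¹ * (R * Rᵀ)) * (R * Rᵀ)⁻¹ * M * (Cᵀ * C)⁻¹ * Cᵀ := by
          simp only [Matrix.mul_assoc]
      _ = _ := by rw [nonsing_inv_mul _ hR, Matrix.mul_one]
  · rw [hBA]
    simp [transpose_nonsing_inv, Matrix.mul_assoc]
  · rw [hAB]
    simp [transpose_nonsing_inv, Matrix.mul_assoc]

theorem _root_.ContinuousOn.matrix_inv {X : Type*} [TopologicalSpace X] {f : X → Matrix k k ℝ}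
    {s : Set X} (hf : ContinuousOn f s) (h : ∀ x ∈ s, IsUnit (f x)) :
    ContinuousOn (fun x => (f x)⁻¹) s := by
  have hdet : ContinuousOn (fun x => (f x).det) s :=
    continuous_id.matrix_det.comp_continuousOn hf
  have hadj : ContinuousOn (fun x => (f x).adjugate) s :=
    continuous_id.matrix_adjugate.comp_continuousOn hf
  simp only [inv_def, Ring.inverse_eq_inv']
  exact (hdet.inv₀ fun x hx => ((isUnit_iff_isUnit_det _).1 (h x hx)).ne_zero).smul hadj

theorem _root_.ContinuousOn.matrix_mul {X l o : Type*} [TopologicalSpace X]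
    {f : X → Matrix l m ℝ} {g : X → Matrix m o ℝ} {s : Set X}
    (hf : ContinuousOn f s) (hg : ContinuousOn g s) : ContinuousOn (fun x => f x * g x) s := by
  rw [continuousOn_iff_continuous_domRestrict] at *
  exact Continuous.matrix_mul hf hg

end Matrix

/-- Fix `1 ≤ r ≤ min d ℓ` and injective index sets `I` of `r` rows and `J` of `r`
columns. On the set `S` of real `d × ℓ` matrices of rank exactly `r` whose `r × r`
submatrix with rows `I` and columns `J` is invertible, the Moore–Penrose
pseudo-inverse map `A ↦ A⁺` is continuous. -/
theorem moore_penrose_continuousOn (d ℓ r : ℕ) (hd : 0 < d) (hℓ : 0 < ℓ)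
    (hr : 1 ≤ r) (hrd : r ≤ min d ℓ)
    (I : Fin r → Fin d) (hI : Function.Injective I)
    (J : Fin r → Fin ℓ) (hJ : Function.Injective J)
    (p : Matrix (Fin d) (Fin ℓ) ℝ → Matrix (Fin ℓ) (Fin d) ℝ)
    (hp : ∀ A : Matrix (Fin d) (Fin ℓ) ℝ,
      A * p A * A = A ∧ p A * A * p A = p A ∧
      (p A * A)ᵀ = p A * A ∧ (A * p A)ᵀ = A * p A) :
    ContinuousOn p
      {A : Matrix (Fin d) (Fin ℓ) ℝ | A.rank = r ∧ IsUnit (A.submatrix I J)} := by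
  have hgram {A : Matrix (Fin d) (Fin ℓ) ℝ} (hA : IsUnit (A.submatrix I J)) :
      IsUnit ((A.submatrix id J)ᵀ * A.submatrix id J) ∧
        IsUnit (A.submatrix I id * (A.submatrix I id)ᵀ) := by
    refine ⟨isUnit_transpose_mul_self_of_isUnit_submatrix (I := I) hA, ?_⟩
    have := isUnit_transpose_mul_self_of_isUnit_submatrix (C := (A.submatrix I id)ᵀ) (I := J)
      ((isUnit_transpose (A.submatrix I J)).2 hA)
    rwa [transpose_transpose] at this
  have hsub {a b : Type} (e : a → Fin d) (f : b → Fin ℓ) :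
      Continuous fun A : Matrix (Fin d) (Fin ℓ) ℝ => A.submatrix e f :=
    continuous_id.matrix_submatrix e f
  have hC := hsub id J
  have hR := hsub I id
  refine ContinuousOn.congr (f := fun A : Matrix (Fin d) (Fin ℓ) ℝ =>
    (A.submatrix I id)ᵀ * (A.submatrix I id * (A.submatrix I id)ᵀ)⁻¹ * A.submatrix I J *
      ((A.submatrix id J)ᵀ * A.submatrix id J)⁻¹ * (A.submatrix id J)ᵀ) ?_ ?_
  · have hRinv := (hR.matrix_mul hR.matrix_transpose).continuousOn.matrix_inv
      fun A (hA : A ∈ {A : Matrix (Fin d) (Fin ℓ) ℝ | A.rank = r ∧ IsUnit (A.submatrix I J)}) =>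
        (hgram hA.2).2
    have hCinv := (hC.matrix_transpose.matrix_mul hC).continuousOn.matrix_inv
      fun A (hA : A ∈ {A : Matrix (Fin d) (Fin ℓ) ℝ | A.rank = r ∧ IsUnit (A.submatrix I J)}) =>
        (hgram hA.2).1
    exact (((hR.matrix_transpose.continuousOn.matrix_mul hRinv).matrix_mul
      (hsub I J).continuousOn).matrix_mul hCinv).matrix_mul hC.matrix_transpose.continuousOn
  · rintro A ⟨hrank, hA⟩
    have hfac := isMoorePenroseInverse_of_factorization hA (hgram hA).1 (hgram hA).2
    rw [← eq_skeleton_of_rank_eq (by simpa using hrank) hA] at hfac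
    exact IsMoorePenroseInverse.unique (hp A) hfac
end

section
/- Let (Ω, ℱ̄, P̃) be a probability space and let ℱ_t, ℋ, 𝒢_t, 𝒢 be sub-σ-algebras of ℱ̄ satisfying: 𝒢_t ⊆ ℱ_t; ℋ is independent of ℱ_t under P̃; and 𝒢_t ⊆ 𝒢 ⊆ σ(𝒢_t ∪ ℋ). Then for every integrable, ℱ_t-measurable random variable U, one has Ẽ[U ∣ 𝒢] = Ẽ[U ∣ 𝒢_t] almost surely. -/
open MeasureTheory ProbabilityTheory

/-- The join of two σ-algebras is generated by the intersections of their measurable sets. -/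
theorem MeasurableSpace.sup_eq_generateFrom_image2_inter {Ω : Type*} (m₁ m₂ : MeasurableSpace Ω) :
    m₁ ⊔ m₂ = MeasurableSpace.generateFrom
      (Set.image2 (· ∩ ·) {s | MeasurableSet[m₁] s} {s | MeasurableSet[m₂] s}) := by
  refine le_antisymm (sup_le ?_ ?_) (MeasurableSpace.generateFrom_le ?_)
  · exact fun s hs => MeasurableSpace.measurableSet_generateFrom
      ⟨s, hs, Set.univ, MeasurableSet.univ, Set.inter_univ s⟩
  · exact fun s hs => MeasurableSpace.measurableSet_generateFrom
      ⟨Set.univ, MeasurableSet.univ, s, hs, Set.univ_inter s⟩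
  · rintro _ ⟨s, hs, t, ht, rfl⟩
    exact MeasurableSet.inter (le_sup_left (b := m₂) s hs) (le_sup_right (a := m₁) t ht)

theorem isPiSystem_image2_inter {Ω : Type*} {S T : Set (Set Ω)} (hS : IsPiSystem S)
    (hT : IsPiSystem T) : IsPiSystem (Set.image2 (· ∩ ·) S T) := by
  rintro _ ⟨s, hs, t, ht, rfl⟩ _ ⟨s', hs', t', ht', rfl⟩ hne
  have heq : (s ∩ t) ∩ (s' ∩ t') = (s ∩ s') ∩ (t ∩ t') := Set.inter_inter_inter_comm s t s' t'
  simp only [heq] at hne ⊢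
  exact ⟨s ∩ s', hS s hs s' hs' hne.left, t ∩ t', hT t ht t' ht' hne.right, rfl⟩

section

variable {Ω : Type*} {m0 : MeasurableSpace Ω} {μ : Measure Ω} [IsProbabilityMeasure μ]

/-- The integral of `f` over an event independent of `f` factorizes. -/
theorem setIntegral_eq_measureReal_mul_integral_of_indep {mF mH : MeasurableSpace Ω}
    (hmF : mF ≤ m0) (hmH : mH ≤ m0) (hindep : Indep mH mF μ) {f : Ω → ℝ}
    (hf : StronglyMeasurable[mF] f) (hfint : Integrable f μ) {B : Set Ω}
    (hB : MeasurableSet[mH] B) :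
    ∫ x in B, f x ∂μ = μ.real B * ∫ x, f x ∂μ := by
  rw [← setIntegral_condExp hmH hfint hB,
    setIntegral_congr_ae (g := fun _ => ∫ x, f x ∂μ) (hmH B hB)
      ((condExp_indep_eq hmF hmH hf hindep.symm).mono fun _ hx _ => hx),
    setIntegral_const, smul_eq_mul]

theorem setIntegral_condExp_of_measurableSet_sup {mF mH mGt : MeasurableSpace Ω}
    (hmF : mF ≤ m0) (hmH : mH ≤ m0) (hGtF : mGt ≤ mF) (hindep : Indep mH mF μ) {U : Ω → ℝ}
    (hU : StronglyMeasurable[mF] U) (hUint : Integrable U μ) {s : Set Ω}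
    (hs : MeasurableSet[mGt ⊔ mH] s) :
    ∫ x in s, (μ[U|mGt]) x ∂μ = ∫ x in s, U x ∂μ := by
  have hmGt : mGt ≤ m0 := hGtF.trans hmF
  have hsup : mGt ⊔ mH ≤ m0 := sup_le hmGt hmH
  have hVint : Integrable (μ[U|mGt]) μ := integrable_condExp
  induction s, hs using MeasurableSpace.induction_on_inter
    (MeasurableSpace.sup_eq_generateFrom_image2_inter mGt mH)
    (isPiSystem_image2_inter (@MeasurableSpace.isPiSystem_measurableSet _ mGt)
      (@MeasurableSpace.isPiSystem_measurableSet _ mH)) with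
  | empty => simp
  | basic t ht =>
    obtain ⟨A, hA, B, hB, rfl⟩ := ht
    have hA0 := hmGt A hA
    have factor : ∀ f : Ω → ℝ, StronglyMeasurable[mF] f → Integrable f μ →
        ∫ x in A ∩ B, f x ∂μ = μ.real B * ∫ x in A, f x ∂μ := fun f hf hfint => by
      rw [Set.inter_comm, ← setIntegral_indicator hA0, ← integral_indicator hA0]
      exact setIntegral_eq_measureReal_mul_integral_of_indep hmF hmH hindep
        (hf.indicator (hGtF A hA)) (hfint.indicator hA0) hB
    rw [factor _ (stronglyMeasurable_condExp.mono hGtF) hVint, factor U hU hUint,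
      setIntegral_condExp hmGt hUint hA]
  | compl t ht ih =>
    have hV := integral_add_compl (hsup t ht) hVint
    have hU' := integral_add_compl (hsup t ht) hUint
    have htot := integral_condExp (μ := μ) (f := U) hmGt
    linarith
  | iUnion f hd hf ih =>
    rw [integral_iUnion (fun i => hsup _ (hf i)) hd hVint.integrableOn,
      integral_iUnion (fun i => hsup _ (hf i)) hd hUint.integrableOn]
    exact tsum_congr ih

end

/-- If `𝒢ₜ ⊆ ℱₜ`, `ℋ` is independent of `ℱₜ`, and `𝒢ₜ ⊆ 𝒢 ⊆ σ(𝒢ₜ ∪ ℋ)`, then for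
every integrable `ℱₜ`-measurable random variable `U`, `Ẽ[U ∣ 𝒢] = Ẽ[U ∣ 𝒢ₜ]` a.s. -/
theorem condexp_eq_of_indep {Ω : Type*} [m0 : MeasurableSpace Ω]
    (μ : Measure Ω) [IsProbabilityMeasure μ]
    (mF mH mGt mG : MeasurableSpace Ω)
    (hmF : mF ≤ m0) (hmH : mH ≤ m0) (hmGt : mGt ≤ m0) (hmG : mG ≤ m0)
    (hGtF : mGt ≤ mF) (hindep : Indep mH mF μ)
    (hGtG : mGt ≤ mG) (hGsup : mG ≤ mGt ⊔ mH)
    (U : Ω → ℝ) (hUmeas : Measurable[mF] U) (hUint : Integrable U μ) :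
    μ[U|mG] =ᵐ[μ] μ[U|mGt] := by
  refine (ae_eq_condExp_of_forall_setIntegral_eq hmG hUint
    (fun _ _ _ => integrable_condExp.integrableOn) (fun s hs _ => ?_)
    (stronglyMeasurable_condExp.mono hGtG).aestronglyMeasurable).symm
  exact setIntegral_condExp_of_measurableSet_sup hmF hmH hGtF hindep
    hUmeas.stronglyMeasurable hUint (hGsup s hs)
end
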